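/- arXiv:1501.02085 — 2 statements merged into one kernel-verified Lean document; each statement's English description precedes it below -/
import Mathlib

section
/- Let a > 0, C > 0, D ≥ 0, set z_min = (3a/(7C))^{3/4}, and assume the smallness condition D < (4a/7)·z_min. Let y : [0,∞) → ℝ be differentiable with y(t) ≥ 0 for all t ≥ 0, y(0) ≤ z_min, and y′(t) ≤ -a·y(t) + C·y(t)^{7/3} + D for all t ≥ 0. Then y(t) ≤ z_min for all t ≥ 0. -/
theorem invariant_region_small_data (a C D : ℝ) (ha : 0 < a) (hC : 0 < C) (hD : 0 ≤ D)
    (hsmall : D < (4*a/7) * ((3*a/(7*C)) ^ ((3:ℝ)/4)))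
    (y : ℝ → ℝ)
    (hy : ∀ t : ℝ, 0 ≤ t → DifferentiableAt ℝ y t)
    (hyn : ∀ t : ℝ, 0 ≤ t → 0 ≤ y t)
    (hy0 : y 0 ≤ (3*a/(7*C)) ^ ((3:ℝ)/4))
    (hineq : ∀ t : ℝ, 0 ≤ t → deriv y t ≤ -a * y t + C * y t ^ ((7:ℝ)/3) + D) :
    ∀ t : ℝ, 0 ≤ t → y t ≤ (3*a/(7*C)) ^ ((3:ℝ)/4) := by
  intro t ht
  have hw : 0 < 3*a/(7*C) := by positivity
  have hCw : C * (3*a/(7*C)) = 3*a/7 := by field_simp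
  have hpow : ((3*a/(7*C)) ^ ((3:ℝ)/4)) ^ ((7:ℝ)/3)
      = (3*a/(7*C)) * (3*a/(7*C)) ^ ((3:ℝ)/4) := by
    rw [← Real.rpow_mul hw.le, show (3:ℝ)/4 * (7/3) = 1 + 3/4 by norm_num,
      Real.rpow_add hw, Real.rpow_one]
  refine image_le_of_deriv_right_lt_deriv_boundary (f := y) (f' := deriv y) (a := 0) (b := t)
    (B := fun _ => (3*a/(7*C)) ^ ((3:ℝ)/4)) (B' := fun _ => 0)
    (fun x hx => (hy x hx.1).continuousAt.continuousWithinAt)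
    (fun x hx => (hy x hx.1).hasDerivAt.hasDerivWithinAt) hy0
    (fun x => hasDerivAt_const x _) ?_ (Set.right_mem_Icc.2 ht)
  intro x hx hxy
  have h := hineq x hx.1
  rw [hxy] at h
  rw [hpow, ← mul_assoc, hCw] at h
  linarith
end

section
/- For every x > 0 and every α ∈ (0,1), the integral ∫₀^∞ λ^{α} · x²/(λ+x)² dλ converges and (sin(πα)/(απ)) · ∫₀^∞ λ^{α} · x²/(λ+x)² dλ = x^{1+α}. -/
open MeasureTheory Real

lemma beta_aux (α : ℝ) (hα : 0 < α) (hα1 : α < 1) :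
    IntegrableOn (fun t : ℝ => t ^ α * (1 - t) ^ (-α)) (Set.Ioo 0 1) volume ∧
    ∫ t in Set.Ioo (0:ℝ) 1, t ^ α * (1 - t) ^ (-α) = α * (π / Real.sin (π * α)) := by
  have hu : 0 < (((1 + α : ℝ)) : ℂ).re := by rw [Complex.ofReal_re]; linarith
  have hv : 0 < (((1 - α : ℝ)) : ℂ).re := by rw [Complex.ofReal_re]; linarith
  have hc := Complex.betaIntegral_convergent hu hv
  have hb := Complex.betaIntegral_eq_Gamma_mul_div _ _ hu hv
  rw [Complex.betaIntegral, intervalIntegral.integral_of_le zero_le_one,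
    integral_Ioc_eq_integral_Ioo] at hb
  rw [intervalIntegrable_iff_integrableOn_Ioo_of_le zero_le_one] at hc
  have heq : Set.EqOn (fun x : ℝ => (x : ℂ) ^ (((1 + α : ℝ) : ℂ) - 1) *
      (1 - (x : ℂ)) ^ (((1 - α : ℝ) : ℂ) - 1))
      (fun t : ℝ => ((t ^ α * (1 - t) ^ (-α) : ℝ) : ℂ)) (Set.Ioo 0 1) := by
    intro t ht
    simp only
    rw [Complex.ofReal_mul, Complex.ofReal_cpow ht.1.le,
      Complex.ofReal_cpow (by linarith [ht.2])]
    push_cast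
    congr 2 <;> ring
  rw [setIntegral_congr_fun measurableSet_Ioo heq, integral_complex_ofReal] at hb
  constructor
  · have h := (hc.congr_fun heq measurableSet_Ioo).re
    simpa [IntegrableOn] using h
  · rw [← Complex.ofReal_add, Complex.Gamma_ofReal, Complex.Gamma_ofReal,
      Complex.Gamma_ofReal] at hb
    norm_cast at hb
    rw [hb, ← Real.Gamma_mul_Gamma_one_sub, show (1 + α) + (1 - α) = (2 : ℝ) by ring,
      Real.Gamma_two, add_comm, Real.Gamma_add_one hα.ne']
    ring

theorem balakrishnan_scalar_one_plus_alpha (x α : ℝ) (hx : 0 < x) (hα : 0 < α) (hα1 : α < 1) :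
    IntegrableOn (fun lam : ℝ => lam ^ α * x ^ 2 / (lam + x) ^ 2) (Set.Ioi 0) volume ∧
    (Real.sin (π * α) / (α * π)) *
        ∫ lam in Set.Ioi (0:ℝ), lam ^ α * x ^ 2 / (lam + x) ^ 2 = x ^ (1 + α) := by
  obtain ⟨h1, h2⟩ := beta_aux α hα hα1
  have himg : (fun l : ℝ => l / (l + x)) '' Set.Ioi 0 = Set.Ioo 0 1 := by
    ext t
    constructor
    · rintro ⟨l, hl, rfl⟩
      have hl : 0 < l := hl
      refine ⟨by positivity, ?_⟩
      simp only
      rw [div_lt_one (by positivity)]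
      linarith
    · rintro ⟨h0, h1⟩
      have h1' : 0 < 1 - t := by linarith
      refine ⟨x * t / (1 - t), ?_, ?_⟩
      · show 0 < x * t / (1 - t)
        positivity
      · have : x * t / (1 - t) + x = x / (1 - t) := by field_simp; ring
        simp only [this]
        field_simp
  have hd : ∀ l ∈ Set.Ioi (0:ℝ), HasDerivWithinAt (fun l : ℝ => l / (l + x))
      (x / (l + x) ^ 2) (Set.Ioi 0) l := by
    intro l hl
    have hl : 0 < l := hl
    have h := ((hasDerivAt_id l).div ((hasDerivAt_id l).add_const x)
      (by simp only [id]; positivity)).hasDerivWithinAt (s := Set.Ioi 0)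
    convert! h using 1
    simp
  have hinj : Set.InjOn (fun l : ℝ => l / (l + x)) (Set.Ioi 0) := by
    intro a ha b hb h
    have ha : 0 < a := ha
    have hb : 0 < b := hb
    simp only at h
    rw [div_eq_div_iff (by positivity) (by positivity)] at h
    have : x * (a - b) = 0 := by linarith
    rcases mul_eq_zero.1 this with h | h <;> linarith
  rw [← himg, integrableOn_image_iff_integrableOn_abs_deriv_smul measurableSet_Ioi hd hinj] at h1
  rw [← himg, integral_image_eq_integral_abs_deriv_smul measurableSet_Ioi hd hinj] at h2
  have heq : Set.EqOn (fun l : ℝ => x ^ (1 + α) * (|x / (l + x) ^ 2| •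
      ((l / (l + x)) ^ α * (1 - l / (l + x)) ^ (-α))))
      (fun lam : ℝ => lam ^ α * x ^ 2 / (lam + x) ^ 2) (Set.Ioi 0) := by
    intro l hl
    have hl : 0 < l := hl
    have hlx : 0 < l + x := by positivity
    have e : 1 - l / (l + x) = x / (l + x) := by field_simp; ring
    simp only [smul_eq_mul]
    rw [e, abs_of_pos (by positivity), Real.rpow_neg (by positivity),
      Real.div_rpow hl.le hlx.le, Real.div_rpow hx.le hlx.le, Real.rpow_add hx, Real.rpow_one]
    have p1 := Real.rpow_pos_of_pos hlx α
    have p2 := Real.rpow_pos_of_pos hx α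
    field_simp
  refine ⟨IntegrableOn.congr_fun (h1.const_mul (x ^ (1 + α))) heq measurableSet_Ioi, ?_⟩
  rw [← setIntegral_congr_fun measurableSet_Ioi heq, integral_const_mul, h2]
  have hs : 0 < Real.sin (π * α) :=
    Real.sin_pos_of_pos_of_lt_pi (by positivity) (by nlinarith [Real.pi_pos])
  have := Real.pi_pos
  field_simp
end
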